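/- If R is a left GF-closed ring, then l.FFD(R) = l.FGFD(R); if R is a right GF-closed ring, then r.FFD(R) = r.FGFD(R). -/

import Mathlib

/-!
Background definitions for D. Bennis, "Weak Gorenstein global dimensions".

Conventions.  All rings are associative with identity.  A *left* `R`-module is a type with
`[AddCommGroup M] [Module R M]`; a *right* `R`-module is a left module over the opposite ring,
i.e. `[Module Rᵐᵒᵖ M]`.  All "right-handed" notions below are obtained by applying the
corresponding "left-handed" notion to the opposite ring `Rᵐᵒᵖ`.
-/

open MulOpposite

universe u

section Tensor

variable (S : Type u) [Ring S]

/-- The subgroup of relations defining the tensor product `A ⊗_S M` of a right `S`-module `A`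
and a left `S`-module `M` over a (possibly noncommutative) ring `S`. -/
def tensorRels (A : Type u) [AddCommGroup A] [Module Sᵐᵒᵖ A]
    (M : Type u) [AddCommGroup M] [Module S M] :
    AddSubgroup (FreeAbelianGroup (A × M)) :=
  AddSubgroup.closure
    { x | (∃ a₁ a₂ m, x = FreeAbelianGroup.of (a₁ + a₂, m) - FreeAbelianGroup.of (a₁, m) -
            FreeAbelianGroup.of (a₂, m)) ∨
          (∃ a m₁ m₂, x = FreeAbelianGroup.of (a, m₁ + m₂) - FreeAbelianGroup.of (a, m₁) -
            FreeAbelianGroup.of (a, m₂)) ∨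
          (∃ (a : A) (r : S) (m : M), x = FreeAbelianGroup.of (op r • a, m) - FreeAbelianGroup.of (a, r • m)) }

/-- The tensor product `A ⊗_S M` (an abelian group) of a right `S`-module `A` and a left
`S`-module `M` over a (possibly noncommutative) ring `S`. -/
def NTensor (A : Type u) [AddCommGroup A] [Module Sᵐᵒᵖ A]
    (M : Type u) [AddCommGroup M] [Module S M] : Type u :=
  FreeAbelianGroup (A × M) ⧸ tensorRels S A M

instance (A : Type u) [AddCommGroup A] [Module Sᵐᵒᵖ A]
    (M : Type u) [AddCommGroup M] [Module S M] : AddCommGroup (NTensor S A M) :=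
  QuotientAddGroup.Quotient.addCommGroup _

namespace NTensor

variable {S}
variable {A A' : Type u} [AddCommGroup A] [Module Sᵐᵒᵖ A] [AddCommGroup A'] [Module Sᵐᵒᵖ A']
variable {M M' : Type u} [AddCommGroup M] [Module S M] [AddCommGroup M'] [Module S M']

/-- Functoriality of `A ⊗_S −` : the map `A ⊗_S M → A ⊗_S M'` induced by a linear map
`g : M → M'` of left `S`-modules. -/
def rmap (A : Type u) [AddCommGroup A] [Module Sᵐᵒᵖ A] (g : M →ₗ[S] M') :
    NTensor S A M →+ NTensor S A M' :=
  QuotientAddGroup.map (tensorRels S A M) (tensorRels S A M') (FreeAbelianGroup.map (Prod.map id g)) (by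
    simp only [tensorRels]
    refine (AddSubgroup.closure_le _).2 ?_
    rintro x (⟨a₁, a₂, m, rfl⟩ | ⟨a, m₁, m₂, rfl⟩ | ⟨a, r, m, rfl⟩) <;>
      refine SetLike.mem_coe.2 (AddSubgroup.mem_comap.2 (AddSubgroup.subset_closure ?_)) <;>
      simp only [map_sub, map_add, map_smul, FreeAbelianGroup.map_of_apply, Prod.map_apply,
        id_eq, Set.mem_setOf_eq]
    · exact Or.inl ⟨a₁, a₂, g m, rfl⟩
    · exact Or.inr (Or.inl ⟨a, g m₁, g m₂, rfl⟩)
    · exact Or.inr (Or.inr ⟨a, r, g m, rfl⟩))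

/-- Functoriality of `− ⊗_S M` : the map `A ⊗_S M → A' ⊗_S M` induced by a linear map
`f : A → A'` of right `S`-modules. -/
def lmap (M : Type u) [AddCommGroup M] [Module S M] (f : A →ₗ[Sᵐᵒᵖ] A') :
    NTensor S A M →+ NTensor S A' M :=
  QuotientAddGroup.map (tensorRels S A M) (tensorRels S A' M) (FreeAbelianGroup.map (Prod.map f id)) (by
    simp only [tensorRels]
    refine (AddSubgroup.closure_le _).2 ?_
    rintro x (⟨a₁, a₂, m, rfl⟩ | ⟨a, m₁, m₂, rfl⟩ | ⟨a, r, m, rfl⟩) <;>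
      refine SetLike.mem_coe.2 (AddSubgroup.mem_comap.2 (AddSubgroup.subset_closure ?_)) <;>
      simp only [map_sub, map_add, map_smul, FreeAbelianGroup.map_of_apply, Prod.map_apply,
        id_eq, Set.mem_setOf_eq]
    · exact Or.inl ⟨f a₁, f a₂, m, rfl⟩
    · exact Or.inr (Or.inl ⟨f a, m₁, m₂, rfl⟩)
    · exact Or.inr (Or.inr ⟨f a, r, m, rfl⟩))

end NTensor

end Tensor

section Dims

variable (S : Type u) [Ring S]

/-- A left `S`-module `M` is *flat* if tensoring with it preserves injectivity of maps of
right `S`-modules. -/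
def IsFlatMod (M : ModuleCat.{u} S) : Prop :=
  ∀ (A B : Type u) [AddCommGroup A] [Module Sᵐᵒᵖ A] [AddCommGroup B] [Module Sᵐᵒᵖ B]
    (f : A →ₗ[Sᵐᵒᵖ] B), Function.Injective f →
      Function.Injective (NTensor.lmap (↥M) f)

/-- A left `S`-module `M` is *Gorenstein flat* if there is an exact sequence
`⋯ → F (-1) → F 0 → F 1 → ⋯` of flat left `S`-modules with `M ≅ Im (F 0 → F 1)` which stays
exact after applying `I ⊗_S −` for every injective right `S`-module `I`
(a *complete flat resolution*). -/
def IsGorensteinFlat (M : ModuleCat.{u} S) : Prop :=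
  ∃ (F : ℤ → ModuleCat.{u} S) (d : ∀ n : ℤ, ↥(F n) →ₗ[S] ↥(F (n + 1))),
    (∀ n, IsFlatMod S (F n)) ∧
    (∀ n, Function.Exact (d n) (d (n + 1))) ∧
    Nonempty (↥M ≃ₗ[S] ↥(LinearMap.range (d 0))) ∧
    (∀ (I : Type u) [AddCommGroup I] [Module Sᵐᵒᵖ I], Module.Injective Sᵐᵒᵖ I →
      ∀ n, Function.Exact (NTensor.rmap I (d n)) (NTensor.rmap I (d (n + 1))))

/-- `gflatDimLE S n M` means `Gfd_S(M) ≤ n`: there is an exact sequence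
`0 → G_n → ⋯ → G_0 → M → 0` of left `S`-modules with all `G_i` Gorenstein flat. -/
def gflatDimLE : ℕ → ModuleCat.{u} S → Prop
  | 0, M => IsGorensteinFlat S M
  | n + 1, M => ∃ (K G : ModuleCat.{u} S) (ι : ↥K →ₗ[S] ↥G) (π : ↥G →ₗ[S] ↥M),
      Function.Injective ι ∧ Function.Surjective π ∧ Function.Exact ι π ∧
      IsGorensteinFlat S G ∧ gflatDimLE n K

/-- `flatDimLE S n M` means `fd_S(M) ≤ n`: there is an exact sequence
`0 → F_n → ⋯ → F_0 → M → 0` of left `S`-modules with all `F_i` flat. -/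
def flatDimLE : ℕ → ModuleCat.{u} S → Prop
  | 0, M => IsFlatMod S M
  | n + 1, M => ∃ (K F : ModuleCat.{u} S) (ι : ↥K →ₗ[S] ↥F) (π : ↥F →ₗ[S] ↥M),
      Function.Injective ι ∧ Function.Surjective π ∧ Function.Exact ι π ∧
      IsFlatMod S F ∧ flatDimLE n K

/-- `injDimLE S n M` means `id_S(M) ≤ n`: there is an exact sequence
`0 → M → I^0 → ⋯ → I^n → 0` of left `S`-modules with all `I^i` injective. -/
def injDimLE : ℕ → ModuleCat.{u} S → Prop
  | 0, M => Module.Injective S ↥M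
  | n + 1, M => ∃ (I C : ModuleCat.{u} S) (ι : ↥M →ₗ[S] ↥I) (π : ↥I →ₗ[S] ↥C),
      Function.Injective ι ∧ Function.Surjective π ∧ Function.Exact ι π ∧
      Module.Injective S ↥I ∧ injDimLE n C

/-- The Gorenstein flat dimension `Gfd_S(M) ∈ ℕ∞` of a left `S`-module `M`. -/
noncomputable def gflatDim (M : ModuleCat.{u} S) : ℕ∞ :=
  sInf {d : ℕ∞ | ∃ n : ℕ, d = n ∧ gflatDimLE S n M}

/-- The flat dimension `fd_S(M) ∈ ℕ∞` of a left `S`-module `M`. -/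
noncomputable def flatDim (M : ModuleCat.{u} S) : ℕ∞ :=
  sInf {d : ℕ∞ | ∃ n : ℕ, d = n ∧ flatDimLE S n M}

/-- The injective dimension `id_S(M) ∈ ℕ∞` of a left `S`-module `M`. -/
noncomputable def injDim (M : ModuleCat.{u} S) : ℕ∞ :=
  sInf {d : ℕ∞ | ∃ n : ℕ, d = n ∧ injDimLE S n M}

/-- The left weak Gorenstein global dimension
`l.Gwdim(S) = sup { Gfd_S(M) | M a left S-module }`.  The right weak Gorenstein global
dimension of `S` is `gorensteinWeakGlobalDim Sᵐᵒᵖ`. -/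
noncomputable def gorensteinWeakGlobalDim : ℕ∞ :=
  ⨆ M : ModuleCat.{u} S, gflatDim S M

/-- The left weak global dimension `sup { fd_S(M) | M a left S-module }`.  (By a classical
theorem it agrees with `weakGlobalDim Sᵐᵒᵖ`, and the common value is `wdim S`.) -/
noncomputable def weakGlobalDim : ℕ∞ :=
  ⨆ M : ModuleCat.{u} S, flatDim S M

/-- The left finitistic flat dimension
`l.FFD(S) = sup { fd_S(M) | M a left S-module with fd_S(M) < ∞ }`. -/
noncomputable def finitisticFlatDim : ℕ∞ :=
  sSup {d : ℕ∞ | d ≠ ⊤ ∧ ∃ M : ModuleCat.{u} S, flatDim S M = d}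

/-- The left finitistic Gorenstein flat dimension
`l.FGFD(S) = sup { Gfd_S(M) | M a left S-module with Gfd_S(M) < ∞ }`. -/
noncomputable def finitisticGFlatDim : ℕ∞ :=
  sSup {d : ℕ∞ | d ≠ ⊤ ∧ ∃ M : ModuleCat.{u} S, gflatDim S M = d}

/-- A ring `S` is *left GF-closed* if the class of Gorenstein flat left `S`-modules is closed
under extensions.  `S` is right GF-closed iff `Sᵐᵒᵖ` is left GF-closed, and GF-closed if both. -/
def IsGFClosed : Prop :=
  ∀ (A B C : ModuleCat.{u} S) (f : ↥A →ₗ[S] ↥B) (g : ↥B →ₗ[S] ↥C),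
    Function.Injective f → Function.Surjective g → Function.Exact f g →
      IsGorensteinFlat S A → IsGorensteinFlat S C → IsGorensteinFlat S B

/-- A ring `S` is *left coherent* if every finitely generated left ideal of `S` is finitely
presented (as a left `S`-module).  `S` is right coherent iff `Sᵐᵒᵖ` is left coherent. -/
def IsLeftCoherent : Prop :=
  ∀ I : Submodule S S, I.FG → Module.FinitePresentation S ↥I

/-- A ring `S` is *left IF* if every injective left `S`-module is flat.  `S` is right IF iff
`Sᵐᵒᵖ` is left IF, and IF if both. -/
def IsLeftIF : Prop :=
  ∀ E : ModuleCat.{u} S, Module.Injective S ↥E → IsFlatMod S E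

/-- A ring `S` is *left `n`-IF* if `fd_S(E) ≤ n` for every injective left `S`-module `E`.
`S` is right `n`-IF iff `Sᵐᵒᵖ` is left `n`-IF, and `n`-IF if both. -/
def IsLeftNIF (n : ℕ) : Prop :=
  ∀ E : ModuleCat.{u} S, Module.Injective S ↥E → flatDim S E ≤ (n : ℕ∞)

/-- `Ext¹_S(T, K) = 0`, expressed by its standard characterization: every extension of `T`
by `K` (i.e. every short exact sequence `0 → K → X → T → 0`) splits. -/
def Ext1Zero (T K : ModuleCat.{u} S) : Prop :=
  ∀ (X : ModuleCat.{u} S) (ι : ↥K →ₗ[S] ↥X) (π : ↥X →ₗ[S] ↥T),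
    Function.Injective ι → Function.Surjective π → Function.Exact ι π →
      ∃ ρ : ↥X →ₗ[S] ↥K, ρ.comp ι = LinearMap.id

/-- A left `S`-module `K` is *cotorsion* if `Ext¹_S(F, K) = 0` for every flat left
`S`-module `F`. -/
def IsCotorsion (K : ModuleCat.{u} S) : Prop :=
  ∀ F : ModuleCat.{u} S, IsFlatMod S F → Ext1Zero S F K

/-- `Tor₁^S(A, T) = 0` for a right `S`-module `A` and a left `S`-module `T`, expressed by its
standard characterization: for every short exact sequence `0 → K → F → T → 0` of left
`S`-modules with `F` flat, the induced map `A ⊗_S K → A ⊗_S F` is injective. -/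
def Tor1Zero (A : Type u) [AddCommGroup A] [Module Sᵐᵒᵖ A] (T : ModuleCat.{u} S) : Prop :=
  ∀ (K F : ModuleCat.{u} S) (ι : ↥K →ₗ[S] ↥F) (π : ↥F →ₗ[S] ↥T),
    IsFlatMod S F → Function.Injective ι → Function.Surjective π → Function.Exact ι π →
      Function.Injective (NTensor.rmap A ι)

/-- A left `S`-module is *finitely presented* if it admits a presentation with finitely many
generators and relations. -/
abbrev IsFinitelyPresented (M : ModuleCat.{u} S) : Prop :=
  Module.FinitePresentation S ↥M

end Dims

section CharacterDual

theorem exists_character_comp_eq {B C : Type u} [AddCommGroup B] [AddCommGroup C] (g : B →+ C)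
    (φ : B →+ AddCircle (1 : ℚ)) (h : ∀ b, g b = 0 → φ b = 0) :
    ∃ ψ : C →+ AddCircle (1 : ℚ), ψ.comp g = φ := by
  obtain ⟨ψ, hψ⟩ := (Module.Baer.of_divisible (AddCircle (1 : ℚ))).extension_property_addMonoidHom
    (QuotientAddGroup.kerLift g) (QuotientAddGroup.kerLift_injective g)
    (QuotientAddGroup.lift g.ker φ fun b hb => h b hb)
  refine ⟨ψ, AddMonoidHom.ext fun b => ?_⟩
  exact DFunLike.congr_fun hψ (QuotientAddGroup.mk b)

theorem exact_iff_forall_character {A B C : Type u} [AddCommGroup A] [AddCommGroup B]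
    [AddCommGroup C] (f : A →+ B) (g : B →+ C) (hgf : g.comp f = 0) :
    Function.Exact f g ↔ ∀ φ : B →+ AddCircle (1 : ℚ), φ.comp f = 0 →
      ∃ ψ : C →+ AddCircle (1 : ℚ), ψ.comp g = φ := by
  constructor
  · intro h φ hφ
    refine exists_character_comp_eq g φ fun b hb => ?_
    obtain ⟨a, rfl⟩ := (h b).1 hb
    exact DFunLike.congr_fun hφ a
  · intro h b
    refine ⟨fun hb => ?_, ?_⟩
    · by_contra hne
      have hq : (QuotientAddGroup.mk b : B ⧸ f.range) ≠ 0 := fun h0 =>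
        hne ((QuotientAddGroup.eq_zero_iff b).1 h0)
      obtain ⟨c, hc⟩ := CharacterModule.exists_character_apply_ne_zero_of_ne_zero hq
      obtain ⟨ψ, hψ⟩ := h (AddMonoidHom.comp c (QuotientAddGroup.mk' f.range)) (by
        ext a
        have : (QuotientAddGroup.mk (f a) : B ⧸ f.range) = 0 :=
          (QuotientAddGroup.eq_zero_iff _).2 ⟨a, rfl⟩
        exact (congrArg c this).trans (map_zero c))
      apply hc
      refine (DFunLike.congr_fun hψ b).symm.trans ?_
      simp [hb]
    · rintro ⟨a, rfl⟩
      exact DFunLike.congr_fun hgf a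

theorem injective_iff_forall_character {A B : Type u} [AddCommGroup A] [AddCommGroup B]
    (f : A →+ B) :
    Function.Injective f ↔ ∀ φ : A →+ AddCircle (1 : ℚ),
      ∃ ψ : B →+ AddCircle (1 : ℚ), ψ.comp f = φ := by
  constructor
  · intro h φ
    refine exists_character_comp_eq f φ fun a ha => ?_
    rw [(injective_iff_map_eq_zero f).1 h a ha, map_zero]
  · intro h
    refine (injective_iff_map_eq_zero f).2 fun a ha => ?_
    by_contra hne
    obtain ⟨c, hc⟩ := CharacterModule.exists_character_apply_ne_zero_of_ne_zero hne
    obtain ⟨ψ, hψ⟩ := h c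
    apply hc
    refine (DFunLike.congr_fun hψ a).symm.trans ?_
    simp [ha]

variable {S : Type u} [Ring S]

/-- The character module `Hom_ℤ(A, ℚ/ℤ)` of a right module is a left module. -/
instance CharacterModule.moduleOfRight (A : Type u) [AddCommGroup A] [Module Sᵐᵒᵖ A] :
    Module S (CharacterModule A) where
  smul s c := AddMonoidHom.comp c (DistribSMul.toAddMonoidHom A (op s))
  one_smul c := by
    ext a
    exact congrArg c (one_smul Sᵐᵒᵖ a)
  mul_smul s t c := by
    ext a
    exact congrArg c (mul_smul (op t) (op s) a)
  smul_zero s := rfl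
  smul_add s c c' := rfl
  add_smul s t c := by
    ext a
    exact (congrArg c (add_smul (op s) (op t) a)).trans (map_add c _ _)
  zero_smul c := by
    ext a
    exact (congrArg c (zero_smul Sᵐᵒᵖ a)).trans (map_zero c)

variable (S) in
/-- The character module of a right `S`-module, as an object of the category of left modules. -/
abbrev characterDual (A : Type u) [AddCommGroup A] [Module Sᵐᵒᵖ A] : ModuleCat.{u} S :=
  ModuleCat.of S (CharacterModule A)

theorem CharacterModule.right_smul_apply {A : Type u} [AddCommGroup A] [Module Sᵐᵒᵖ A] (s : S)
    (c : CharacterModule A) (a : A) : (s • c) a = c (op s • a) := rfl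

/-- Precomposition with a map of right modules, as a map of left modules. -/
def characterMap {A B : Type u} [AddCommGroup A] [Module Sᵐᵒᵖ A] [AddCommGroup B] [Module Sᵐᵒᵖ B]
    (f : A →ₗ[Sᵐᵒᵖ] B) : CharacterModule B →ₗ[S] CharacterModule A where
  toFun c := AddMonoidHom.comp c f.toAddMonoidHom
  map_add' _ _ := rfl
  map_smul' s c := by
    ext a
    exact congrArg c (f.map_smul (op s) a).symm

section

variable {A B C : Type u} [AddCommGroup A] [Module Sᵐᵒᵖ A] [AddCommGroup B] [Module Sᵐᵒᵖ B]
  [AddCommGroup C] [Module Sᵐᵒᵖ C] {f : A →ₗ[Sᵐᵒᵖ] B} {g : B →ₗ[Sᵐᵒᵖ] C}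

theorem characterMap_apply (c : CharacterModule B) (a : A) : characterMap f c a = c (f a) := rfl

theorem characterMap_surjective (hf : Function.Injective f) :
    Function.Surjective (characterMap f) := fun φ => by
  obtain ⟨ψ, hψ⟩ := (injective_iff_forall_character f.toAddMonoidHom).1 hf φ
  exact ⟨ψ, hψ⟩

theorem characterMap_injective (hg : Function.Surjective g) :
    Function.Injective (characterMap g) := fun φ ψ h => by
  ext c
  obtain ⟨b, rfl⟩ := hg c
  exact DFunLike.congr_fun h b

theorem characterMap_exact (h : Function.Exact f g) :
    Function.Exact (characterMap g) (characterMap f) := fun φ => by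
  constructor
  · intro hφ
    obtain ⟨ψ, hψ⟩ := exists_character_comp_eq g.toAddMonoidHom φ fun b hb => by
      obtain ⟨a, rfl⟩ := (h b).1 hb
      exact DFunLike.congr_fun hφ a
    exact ⟨ψ, hψ⟩
  · rintro ⟨ψ, rfl⟩
    ext a
    rw [characterMap_apply, characterMap_apply, h.apply_apply_eq_zero, map_zero]
    rfl

end

/-- The character module of a free right module is injective. -/
theorem injective_characterModule_finsupp (ι : Type u) :
    Module.Injective S (CharacterModule (ι →₀ Sᵐᵒᵖ)) where
  out X Y _ _ _ _ f hf φ := by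
    have h (i : ι) := (injective_iff_forall_character f.toAddMonoidHom).1 hf
      { toFun := fun x => φ x (Finsupp.single i 1)
        map_zero' := by rw [map_zero]; rfl
        map_add' := fun x y => by rw [map_add]; rfl }
    choose ψ hψ using h
    have hψ' (i : ι) (x : X) : ψ i (f x) = φ x (Finsupp.single i 1) := DFunLike.congr_fun (hψ i) x
    let χ (y : Y) : (ι →₀ Sᵐᵒᵖ) →+ AddCircle (1 : ℚ) := Finsupp.liftAddHom fun i =>
      { toFun := fun r => ψ i (unop r • y)
        map_zero' := by simp
        map_add' := fun r s => by simp [add_smul] }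
    have hχ (y : Y) (i : ι) (r : Sᵐᵒᵖ) : χ y (Finsupp.single i r) = ψ i (unop r • y) := by
      simp [χ]
    refine ⟨{ toFun := χ, map_add' := ?_, map_smul' := ?_ }, fun x => ?_⟩
    · intro y z
      refine Finsupp.addHom_ext fun i r => ?_
      refine Eq.trans ?_ (AddMonoidHom.add_apply (χ y) (χ z) _).symm
      simp only [hχ, smul_add, map_add]
    · intro s y
      refine Finsupp.addHom_ext fun i r => ?_
      rw [hχ]
      refine Eq.trans ?_ (CharacterModule.right_smul_apply (A := ι →₀ Sᵐᵒᵖ) s (χ y) _).symm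
      refine Eq.trans ?_ (congrArg (χ y) (Finsupp.smul_single (op s) i r).symm)
      rw [hχ]
      simp [mul_smul]
    · refine Finsupp.addHom_ext fun i r => ?_
      refine (hχ (f x) i r).trans ?_
      rw [← map_smul, hψ', map_smul, CharacterModule.right_smul_apply, Finsupp.smul_single]
      simp only [op_unop, smul_eq_mul, mul_one]
      rfl

namespace NTensor

variable {A A' : Type u} [AddCommGroup A] [Module Sᵐᵒᵖ A] [AddCommGroup A'] [Module Sᵐᵒᵖ A']
variable {M M' M'' : Type u} [AddCommGroup M] [Module S M] [AddCommGroup M'] [Module S M']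
  [AddCommGroup M''] [Module S M'']

variable (S A M) in
/-- The quotient map from formal sums of pairs onto the tensor product. -/
def proj : FreeAbelianGroup (A × M) →+ NTensor S A M :=
  QuotientAddGroup.mk' (tensorRels S A M)

variable (S) in
/-- Pure tensors. -/
def tmul (a : A) (m : M) : NTensor S A M :=
  proj S A M (FreeAbelianGroup.of (a, m))

theorem proj_eq_proj_of_sub_mem {x y : FreeAbelianGroup (A × M)}
    (h : x - y ∈ tensorRels S A M) : proj S A M x = proj S A M y := by
  rw [← sub_eq_zero, ← map_sub]
  exact (QuotientAddGroup.eq_zero_iff _).2 h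

theorem add_tmul (a₁ a₂ : A) (m : M) : tmul S (a₁ + a₂) m = tmul S a₁ m + tmul S a₂ m := by
  unfold tmul
  rw [← map_add]
  apply proj_eq_proj_of_sub_mem
  rw [← sub_sub]
  exact AddSubgroup.subset_closure (Or.inl ⟨a₁, a₂, m, rfl⟩)

theorem tmul_add (a : A) (m₁ m₂ : M) : tmul S a (m₁ + m₂) = tmul S a m₁ + tmul S a m₂ := by
  unfold tmul
  rw [← map_add]
  apply proj_eq_proj_of_sub_mem
  rw [← sub_sub]
  exact AddSubgroup.subset_closure (Or.inr (Or.inl ⟨a, m₁, m₂, rfl⟩))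

theorem tmul_smul (a : A) (s : S) (m : M) : tmul S a (s • m) = tmul S (op s • a) m :=
  (proj_eq_proj_of_sub_mem (AddSubgroup.subset_closure (Or.inr (Or.inr ⟨a, s, m, rfl⟩)))).symm

theorem hom_ext {X : Type*} [AddCommGroup X] {f g : NTensor S A M →+ X}
    (h : ∀ a m, f (tmul S a m) = g (tmul S a m)) : f = g := by
  exact QuotientAddGroup.addMonoidHom_ext _ (FreeAbelianGroup.lift_ext _ _ fun ⟨a, m⟩ => h a m)

theorem rmap_tmul (g : M →ₗ[S] M') (a : A) (m : M) :
    rmap A g (tmul S a m) = tmul S a (g m) := rfl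

theorem lmap_tmul (f : A →ₗ[Sᵐᵒᵖ] A') (a : A) (m : M) :
    lmap M f (tmul S a m) = tmul S (f a) m := rfl

/-- A character of `A ⊗ M` gives a linear map from `M` to the character module of `A`. -/
def curry (c : NTensor S A M →+ AddCircle (1 : ℚ)) : M →ₗ[S] CharacterModule A where
  toFun m := AddMonoidHom.mk' (fun a => c (tmul S a m)) fun a b => by rw [add_tmul, map_add]
  map_add' m n := by
    ext a
    exact (congrArg c (tmul_add a m n)).trans (map_add c _ _)
  map_smul' s m := by
    ext a
    exact congrArg c (tmul_smul a s m)

/-- A linear map from `M` to the character module of `A` gives a character of `A ⊗ M`. -/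
def uncurry (φ : M →ₗ[S] CharacterModule A) : NTensor S A M →+ AddCircle (1 : ℚ) :=
  QuotientAddGroup.lift (tensorRels S A M) (FreeAbelianGroup.lift fun p => φ p.2 p.1) (by
    refine (AddSubgroup.closure_le _).2 ?_
    rintro x (⟨a₁, a₂, m, rfl⟩ | ⟨a, m₁, m₂, rfl⟩ | ⟨a, r, m, rfl⟩) <;>
      refine SetLike.mem_coe.2 (AddMonoidHom.mem_ker.2 ?_) <;>
      simp only [map_sub, FreeAbelianGroup.lift_apply_of]
    · rw [map_add]
      abel
    · rw [map_add, sub_sub, sub_eq_zero]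
      rfl
    · rw [φ.map_smul, sub_eq_zero]
      rfl)

theorem uncurry_tmul (φ : M →ₗ[S] CharacterModule A) (m : M) (a : A) :
    uncurry φ (tmul S a m) = φ m a :=
  FreeAbelianGroup.lift_apply_of _ _

theorem rmap_exact_iff {f : M →ₗ[S] M'} {g : M' →ₗ[S] M''} (hgf : g ∘ₗ f = 0) :
    Function.Exact (rmap A f) (rmap A g) ↔ ∀ φ : M' →ₗ[S] CharacterModule A, φ ∘ₗ f = 0 →
      ∃ ψ : M'' →ₗ[S] CharacterModule A, ψ ∘ₗ g = φ := by
  rw [exact_iff_forall_character _ _ (hom_ext fun a m => ?_)]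
  · constructor
    · intro h φ hφ
      obtain ⟨ψ, hψ⟩ := h (uncurry φ) (hom_ext fun a m => by
        rw [AddMonoidHom.comp_apply, rmap_tmul, uncurry_tmul]
        exact DFunLike.congr_fun (LinearMap.congr_fun hφ m) a)
      refine ⟨curry ψ, LinearMap.ext fun m => CharacterModule.ext _ fun a => ?_⟩
      exact (DFunLike.congr_fun hψ (tmul S a m)).trans (uncurry_tmul φ m a)
    · intro h φ hφ
      obtain ⟨ψ, hψ⟩ := h (curry φ) (LinearMap.ext fun m => CharacterModule.ext _ fun a =>
        DFunLike.congr_fun hφ (tmul S a m))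
      refine ⟨uncurry ψ, hom_ext fun a m => ?_⟩
      rw [AddMonoidHom.comp_apply, rmap_tmul, uncurry_tmul]
      exact DFunLike.congr_fun (LinearMap.congr_fun hψ m) a
  · rw [AddMonoidHom.comp_apply, rmap_tmul, rmap_tmul, ← LinearMap.comp_apply, hgf]
    have := tmul_add (S := S) a (0 : M'') 0
    rw [add_zero, left_eq_add] at this
    exact this

theorem lmap_injective_iff {f : A →ₗ[Sᵐᵒᵖ] A'} :
    Function.Injective (lmap M f) ↔ ∀ φ : M →ₗ[S] CharacterModule A,
      ∃ ψ : M →ₗ[S] CharacterModule A', characterMap f ∘ₗ ψ = φ := by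
  rw [injective_iff_forall_character]
  constructor
  · intro h φ
    obtain ⟨ψ, hψ⟩ := h (uncurry φ)
    refine ⟨curry ψ, LinearMap.ext fun m => CharacterModule.ext _ fun a => ?_⟩
    exact (DFunLike.congr_fun hψ (tmul S a m)).trans (uncurry_tmul φ m a)
  · intro h φ
    obtain ⟨ψ, hψ⟩ := h (curry φ)
    refine ⟨uncurry ψ, hom_ext fun a m => ?_⟩
    rw [AddMonoidHom.comp_apply, lmap_tmul, uncurry_tmul]
    exact DFunLike.congr_fun (LinearMap.congr_fun hψ m) a

end NTensor

end CharacterDual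

section ShortExact

variable {S : Type u} [Ring S]

/-- `0 → A → B → C → 0` is a short exact sequence. -/
structure IsShortExact {A B C : Type u} [AddCommGroup A] [AddCommGroup B] [AddCommGroup C]
    [Module S A] [Module S B] [Module S C] (f : A →ₗ[S] B) (g : B →ₗ[S] C) : Prop where
  injective : Function.Injective f
  surjective : Function.Surjective g
  exact : Function.Exact f g

section

variable {A B C D : Type u} [AddCommGroup A] [AddCommGroup B] [AddCommGroup C] [AddCommGroup D]
    [Module S A] [Module S B] [Module S C] [Module S D]

theorem isShortExact_subtype_ker {g : B →ₗ[S] C} (hg : Function.Surjective g) :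
    IsShortExact (LinearMap.ker g).subtype g :=
  ⟨Subtype.val_injective, hg, LinearMap.exact_subtype_ker_map g⟩

theorem isShortExact_mkQ_range {f : A →ₗ[S] B} (hf : Function.Injective f) :
    IsShortExact f (LinearMap.range f).mkQ :=
  ⟨hf, Submodule.mkQ_surjective _, LinearMap.exact_map_mkQ_range f⟩

theorem exists_comp_eq_of_surjective {p : A →ₗ[S] B} (hp : Function.Surjective p) (f : A →ₗ[S] C)
    (h : ∀ x, p x = 0 → f x = 0) : ∃ k : B →ₗ[S] C, ∀ x, k (p x) = f x := by
  refine ⟨(LinearMap.ker p).liftQ f (fun x hx => h x hx) ∘ₗ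
    (p.quotKerEquivOfSurjective hp).symm.toLinearMap, fun x => ?_⟩
  have : (p.quotKerEquivOfSurjective hp).symm (p x) = (LinearMap.ker p).mkQ x := by
    rw [LinearEquiv.symm_apply_eq]
    rfl
  exact congrArg _ this

theorem exists_comp_eq_of_injective {f : B →ₗ[S] C} (hf : Function.Injective f) (h : A →ₗ[S] C)
    (hh : ∀ x, ∃ y, f y = h x) : ∃ k : A →ₗ[S] B, ∀ x, f (k x) = h x := by
  refine ⟨(LinearEquiv.ofInjective f hf).symm.toLinearMap ∘ₗ
    h.codRestrict (LinearMap.range f) hh, fun x => ?_⟩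
  exact congrArg Subtype.val ((LinearEquiv.ofInjective f hf).apply_symm_apply _)

theorem IsShortExact.congr_left {f : A →ₗ[S] B} {g : B →ₗ[S] C} (h : IsShortExact f g)
    (e : D ≃ₗ[S] A) : IsShortExact (f ∘ₗ e.toLinearMap) g :=
  ⟨h.injective.comp e.injective, h.surjective, fun b => by
    rw [h.exact b]
    exact ⟨fun ⟨a, ha⟩ => ⟨e.symm a, by simpa using ha⟩, fun ⟨d, hd⟩ => ⟨e d, hd⟩⟩⟩

end

variable {A B C D E : ModuleCat.{u} S}

/-- Pushout of a short exact sequence along the kernel of another one. -/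
theorem IsShortExact.exists_pushout {f : A →ₗ[S] B} {g : B →ₗ[S] C} {f' : A →ₗ[S] D}
    {g' : D →ₗ[S] E} (h : IsShortExact f g) (h' : IsShortExact f' g') :
    ∃ (X : ModuleCat.{u} S) (i : D →ₗ[S] X) (p : X →ₗ[S] C) (i' : B →ₗ[S] X) (p' : X →ₗ[S] E),
      IsShortExact i p ∧ IsShortExact i' p' := by
  let r : A →ₗ[S] D × B := f'.prod (-f)
  have hr (a : A) : r a = (f' a, - f a) := rfl
  let q := (LinearMap.range r).mkQ
  have hq : Function.Surjective q := Submodule.mkQ_surjective _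
  have hq0 (x : D × B) : q x = 0 ↔ ∃ a, r a = x := Submodule.Quotient.mk_eq_zero _
  obtain ⟨p, hp⟩ := exists_comp_eq_of_surjective hq (g ∘ₗ LinearMap.snd S D B) fun x hx => by
    obtain ⟨a, rfl⟩ := (hq0 x).1 hx
    simp [hr, h.exact.apply_apply_eq_zero]
  obtain ⟨p', hp'⟩ := exists_comp_eq_of_surjective hq (g' ∘ₗ LinearMap.fst S D B) fun x hx => by
    obtain ⟨a, rfl⟩ := (hq0 x).1 hx
    simp [hr, h'.exact.apply_apply_eq_zero]
  refine ⟨ModuleCat.of S ((D × B) ⧸ LinearMap.range r), q ∘ₗ LinearMap.inl S D B, p,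
    q ∘ₗ LinearMap.inr S D B, p', ⟨?_, ?_, ?_⟩, ⟨?_, ?_, ?_⟩⟩
  · refine (injective_iff_map_eq_zero _).2 fun d hd => ?_
    obtain ⟨a, ha⟩ := (hq0 _).1 hd
    have h1 : f' a = d := congrArg Prod.fst ha
    have h2 : - f a = 0 := congrArg Prod.snd ha
    rw [neg_eq_zero, map_eq_zero_iff f h.injective] at h2
    rw [← h1, h2, map_zero]
  · intro c
    obtain ⟨b, rfl⟩ := h.surjective c
    exact ⟨q (0, b), hp _⟩
  · intro x
    obtain ⟨⟨d, b⟩, rfl⟩ := hq x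
    rw [hp]
    constructor
    · intro hb
      obtain ⟨a, rfl⟩ := (h.exact b).1 hb
      refine ⟨d + f' a, ?_⟩
      refine sub_eq_zero.1 ((map_sub q _ _).symm.trans ((hq0 _).2 ⟨a, ?_⟩))
      simp [hr]
    · rintro ⟨d', hd'⟩
      refine (hp _).symm.trans ((congrArg p hd').symm.trans ((hp _).trans ?_))
      simp
  · refine (injective_iff_map_eq_zero _).2 fun b hb => ?_
    obtain ⟨a, ha⟩ := (hq0 _).1 hb
    have h1 : f' a = 0 := congrArg Prod.fst ha
    have h2 : - f a = b := congrArg Prod.snd ha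
    rw [map_eq_zero_iff f' h'.injective] at h1
    rw [← h2, h1, map_zero, neg_zero]
  · intro e
    obtain ⟨d, rfl⟩ := h'.surjective e
    exact ⟨q (d, 0), hp' _⟩
  · intro x
    obtain ⟨⟨d, b⟩, rfl⟩ := hq x
    rw [hp']
    constructor
    · intro hd
      obtain ⟨a, rfl⟩ := (h'.exact d).1 hd
      refine ⟨b + f a, ?_⟩
      refine (sub_eq_zero.1 ((map_sub q _ _).symm.trans ((hq0 _).2 ⟨a, ?_⟩))).symm
      simp [hr]
    · rintro ⟨b', hb'⟩
      refine (hp' _).symm.trans ((congrArg p' hb').symm.trans ((hp' _).trans ?_))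
      simp

/-- The cokernels of a composition of monomorphisms form a short exact sequence. -/
theorem IsShortExact.exists_coker_comp {f : A →ₗ[S] B} {g : B →ₗ[S] C} {f' : B →ₗ[S] D}
    {g' : D →ₗ[S] E} (h : IsShortExact f g) (h' : IsShortExact f' g') :
    ∃ (Q : ModuleCat.{u} S) (q : D →ₗ[S] Q) (i : C →ₗ[S] Q) (p : Q →ₗ[S] E),
      IsShortExact (f' ∘ₗ f) q ∧ IsShortExact i p := by
  have hq := isShortExact_mkQ_range (f := f' ∘ₗ f) (h'.injective.comp h.injective)
  obtain ⟨i, hi⟩ := exists_comp_eq_of_surjective h.surjective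
    ((LinearMap.range (f' ∘ₗ f)).mkQ ∘ₗ f') fun x hx => by
      obtain ⟨a, rfl⟩ := (h.exact x).1 hx
      exact hq.exact.apply_apply_eq_zero a
  obtain ⟨p, hp⟩ := exists_comp_eq_of_surjective hq.surjective g' fun x hx => by
    obtain ⟨a, rfl⟩ := (hq.exact x).1 hx
    exact h'.exact.apply_apply_eq_zero _
  refine ⟨ModuleCat.of S (D ⧸ LinearMap.range (f' ∘ₗ f)), _, i, p, hq, ?_, ?_, ?_⟩
  · refine (injective_iff_map_eq_zero _).2 fun c hc => ?_
    obtain ⟨b, rfl⟩ := h.surjective c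
    rw [hi] at hc
    obtain ⟨a, ha⟩ := (hq.exact _).1 hc
    rw [← h'.injective ha]
    exact h.exact.apply_apply_eq_zero a
  · intro e
    obtain ⟨d, rfl⟩ := h'.surjective e
    exact ⟨_, hp d⟩
  · intro x
    obtain ⟨d, rfl⟩ := hq.surjective x
    rw [hp]
    constructor
    · intro hd
      obtain ⟨b, rfl⟩ := (h'.exact d).1 hd
      exact ⟨g b, hi b⟩
    · rintro ⟨c, hc⟩
      obtain ⟨b, rfl⟩ := h.surjective c
      refine (hp d).symm.trans ((congrArg p (hc.symm.trans (hi b))).trans ((hp _).trans ?_))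
      exact h'.exact.apply_apply_eq_zero b

/-- The kernels of a composition of epimorphisms form a short exact sequence. -/
theorem IsShortExact.exists_ker_comp {f : A →ₗ[S] B} {g : B →ₗ[S] C} {f' : D →ₗ[S] C}
    {g' : C →ₗ[S] E} (h : IsShortExact f g) (h' : IsShortExact f' g') :
    ∃ (N : ModuleCat.{u} S) (j : N →ₗ[S] B) (i : A →ₗ[S] N) (p : N →ₗ[S] D),
      IsShortExact j (g' ∘ₗ g) ∧ IsShortExact i p := by
  have hj := isShortExact_subtype_ker (g := g' ∘ₗ g) (h'.surjective.comp h.surjective)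
  obtain ⟨i, hi⟩ := exists_comp_eq_of_injective hj.injective f fun a =>
    (hj.exact _).1 (by simp [h.exact.apply_apply_eq_zero])
  obtain ⟨p, hp⟩ := exists_comp_eq_of_injective h'.injective
    (g ∘ₗ (LinearMap.ker (g' ∘ₗ g)).subtype) fun x => (h'.exact _).1 x.2
  refine ⟨ModuleCat.of S (LinearMap.ker (g' ∘ₗ g)), _, i, p, hj, ?_, ?_, ?_⟩
  · intro a b hab
    apply h.injective
    rw [← hi a, ← hi b, hab]
  · intro d
    obtain ⟨b, hb⟩ := h.surjective (f' d)
    refine ⟨⟨b, ?_⟩, h'.injective ((hp _).trans hb)⟩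
    exact (congrArg g' hb).trans (h'.exact.apply_apply_eq_zero d)
  · intro x
    rw [← map_eq_zero_iff f' h'.injective, hp]
    refine (h.exact x.1).trans ⟨?_, ?_⟩
    · rintro ⟨a, ha⟩
      exact ⟨a, hj.injective ((hi a).trans ha)⟩
    · rintro ⟨a, rfl⟩
      exact ⟨a, (hi a).symm⟩

end ShortExact

section ExtVanishing

open CategoryTheory CategoryTheory.Abelian

variable {S : Type u} [Ring S] {A B C : ModuleCat.{u} S} {f : A →ₗ[S] B} {g : B →ₗ[S] C}

namespace IsShortExact

/-- The short complex of module objects attached to a short exact sequence. -/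
abbrev toShortComplex (h : IsShortExact f g) : ShortComplex (ModuleCat.{u} S) :=
  ShortComplex.mk (ModuleCat.ofHom f) (ModuleCat.ofHom g) (by
    ext x
    exact h.exact.apply_apply_eq_zero x)

theorem shortExact (h : IsShortExact f g) : h.toShortComplex.ShortExact :=
  ModuleCat.shortComplex_shortExact _ h.exact h.injective h.surjective

theorem subsingleton_ext_left (h : IsShortExact f g) (Y : ModuleCat.{u} S) (n : ℕ)
    [Subsingleton (Ext B Y n)] [Subsingleton (Ext C Y (n + 1))] : Subsingleton (Ext A Y n) :=
  subsingleton_of_forall_eq 0 fun x => by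
    obtain ⟨y, rfl⟩ := Ext.contravariant_sequence_exact₁ h.shortExact Y x (add_comm 1 n)
      (Subsingleton.elim (α := Ext C Y (n + 1)) _ _)
    rw [Subsingleton.elim (α := Ext B Y n) y 0, Ext.comp_zero]

theorem subsingleton_ext_right (h : IsShortExact f g) (Y : ModuleCat.{u} S) (n : ℕ)
    [Subsingleton (Ext A Y n)] [Subsingleton (Ext B Y (n + 1))] : Subsingleton (Ext C Y (n + 1)) :=
  subsingleton_of_forall_eq 0 fun x => by
    obtain ⟨y, rfl⟩ := Ext.contravariant_sequence_exact₃ h.shortExact Y x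
      (Subsingleton.elim (α := Ext B Y (n + 1)) _ _) (add_comm 1 n)
    rw [Subsingleton.elim (α := Ext A Y n) y 0, Ext.comp_zero]

theorem subsingleton_ext_one_right (h : IsShortExact f g) (Y : ModuleCat.{u} S)
    [Subsingleton (Ext B Y 1)] (hY : ∀ φ : A →ₗ[S] Y, ∃ ψ : B →ₗ[S] Y, ψ ∘ₗ f = φ) :
    Subsingleton (Ext C Y 1) :=
  subsingleton_of_forall_eq 0 fun x => by
    obtain ⟨y, rfl⟩ := Ext.contravariant_sequence_exact₃ h.shortExact Y x
      (Subsingleton.elim (α := Ext B Y 1) _ _) (add_comm 1 0)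
    obtain ⟨φ, rfl⟩ := (Ext.mk₀_bijective _ _).2 y
    obtain ⟨ψ, hψ⟩ := hY φ.hom
    have : φ = h.toShortComplex.f ≫ ModuleCat.ofHom ψ := by
      ext x
      exact (LinearMap.congr_fun hψ x).symm
    rw [this, ← Ext.mk₀_comp_mk₀]
    exact h.shortExact.extClass_comp_assoc _

theorem exists_extension (h : IsShortExact f g) (Y : ModuleCat.{u} S) [Subsingleton (Ext C Y 1)]
    (φ : A →ₗ[S] Y) : ∃ ψ : B →ₗ[S] Y, ψ ∘ₗ f = φ := by
  obtain ⟨y, hy⟩ := Ext.contravariant_sequence_exact₁ h.shortExact Y (Ext.mk₀ (ModuleCat.ofHom φ))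
    (add_comm 1 0) (Subsingleton.elim (α := Ext C Y 1) _ _)
  obtain ⟨ψ, rfl⟩ := (Ext.mk₀_bijective _ _).2 y
  rw [Ext.mk₀_comp_mk₀] at hy
  have := (Ext.mk₀_bijective _ _).1 hy
  exact ⟨ψ.hom, congrArg ModuleCat.Hom.hom this⟩

theorem subsingleton_ext_covariant_left (h : IsShortExact f g) (X : ModuleCat.{u} S) (n : ℕ)
    [Subsingleton (Ext X C n)] [Subsingleton (Ext X B (n + 1))] : Subsingleton (Ext X A (n + 1)) :=
  subsingleton_of_forall_eq 0 fun x => by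
    obtain ⟨y, rfl⟩ := Ext.covariant_sequence_exact₁ X h.shortExact x
      (Subsingleton.elim (α := Ext X B (n + 1)) _ _) rfl
    rw [Subsingleton.elim (α := Ext X C n) y 0, Ext.zero_comp]

theorem subsingleton_ext_covariant_right (h : IsShortExact f g) (X : ModuleCat.{u} S) (n : ℕ)
    [Subsingleton (Ext X B n)] [Subsingleton (Ext X A (n + 1))] : Subsingleton (Ext X C n) :=
  subsingleton_of_forall_eq 0 fun x => by
    obtain ⟨y, rfl⟩ := Ext.covariant_sequence_exact₃ X h.shortExact x rfl
      (Subsingleton.elim (α := Ext X A (n + 1)) _ _)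
    rw [Subsingleton.elim (α := Ext X B n) y 0, Ext.zero_comp]

theorem subsingleton_ext_one_covariant (h : IsShortExact f g) (X : ModuleCat.{u} S)
    [Subsingleton (Ext X B 1)] (hX : ∀ φ : X →ₗ[S] C, ∃ ψ : X →ₗ[S] B, g ∘ₗ ψ = φ) :
    Subsingleton (Ext X A 1) :=
  subsingleton_of_forall_eq 0 fun x => by
    obtain ⟨y, rfl⟩ := Ext.covariant_sequence_exact₁ X h.shortExact x
      (Subsingleton.elim (α := Ext X B 1) _ _) (zero_add 1)
    obtain ⟨φ, rfl⟩ := (Ext.mk₀_bijective _ _).2 y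
    obtain ⟨ψ, hψ⟩ := hX φ.hom
    have : φ = ModuleCat.ofHom ψ ≫ h.toShortComplex.g := by
      ext x
      exact (LinearMap.congr_fun hψ x).symm
    rw [this, ← Ext.mk₀_comp_mk₀, Ext.comp_assoc_of_second_deg_zero,
      h.shortExact.comp_extClass, Ext.comp_zero]

theorem exists_lift (h : IsShortExact f g) (X : ModuleCat.{u} S) [Subsingleton (Ext X A 1)]
    (φ : X →ₗ[S] C) : ∃ ψ : X →ₗ[S] B, g ∘ₗ ψ = φ := by
  obtain ⟨y, hy⟩ := Ext.covariant_sequence_exact₃ X h.shortExact (Ext.mk₀ (ModuleCat.ofHom φ))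
    (zero_add 1) (Subsingleton.elim (α := Ext X A 1) _ _)
  obtain ⟨ψ, rfl⟩ := (Ext.mk₀_bijective _ _).2 y
  rw [Ext.mk₀_comp_mk₀] at hy
  have := (Ext.mk₀_bijective _ _).1 hy
  exact ⟨ψ.hom, congrArg ModuleCat.Hom.hom this⟩

end IsShortExact

end ExtVanishing

section GorensteinFlat

open CategoryTheory CategoryTheory.Abelian

variable {S : Type u} [Ring S]

theorem exists_free_presentation (M : ModuleCat.{u} S) :
    ∃ (K P : ModuleCat.{u} S) (f : K →ₗ[S] P) (g : P →ₗ[S] M), Projective P ∧ IsShortExact f g :=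
  ⟨ModuleCat.of S (LinearMap.ker (Finsupp.linearCombination S (id : M → M))),
    ModuleCat.of S (M →₀ S), _, _,
    ModuleCat.projective_of_free (M := ModuleCat.of S (M →₀ S)) Finsupp.basisSingleOne,
    isShortExact_subtype_ker (Finsupp.linearCombination_id_surjective S M)⟩

theorem exists_characterDual_presentation (A : Type u) [AddCommGroup A] [Module Sᵐᵒᵖ A] :
    ∃ (N P : Type u) (_ : AddCommGroup N) (_ : Module Sᵐᵒᵖ N) (_ : AddCommGroup P)
      (_ : Module Sᵐᵒᵖ P) (ι : N →ₗ[Sᵐᵒᵖ] P) (π : P →ₗ[Sᵐᵒᵖ] A), Function.Injective ι ∧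
      Injective (characterDual S P) ∧
      IsShortExact (S := S) (characterMap π) (characterMap ι) := by
  let π := Finsupp.linearCombination Sᵐᵒᵖ (id : A → A)
  have h := isShortExact_subtype_ker (g := π) (Finsupp.linearCombination_id_surjective Sᵐᵒᵖ A)
  refine ⟨LinearMap.ker π, A →₀ Sᵐᵒᵖ, inferInstance, inferInstance, inferInstance, inferInstance,
    (LinearMap.ker π).subtype, π, h.injective, ?_, characterMap_injective h.surjective,
    characterMap_surjective h.injective, characterMap_exact h.exact⟩
  have := injective_characterModule_finsupp (S := S) A
  exact Module.injective_object_of_injective_module S (CharacterModule (A →₀ Sᵐᵒᵖ))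

theorem exists_injective_copresentation (A : Type u) [AddCommGroup A] [Module Sᵐᵒᵖ A] :
    ∃ (I D : Type u) (_ : AddCommGroup I) (_ : Module Sᵐᵒᵖ I) (_ : AddCommGroup D)
      (_ : Module Sᵐᵒᵖ D) (ι : A →ₗ[Sᵐᵒᵖ] I) (π : I →ₗ[Sᵐᵒᵖ] D), Module.Injective Sᵐᵒᵖ I ∧
      IsShortExact ι π := by
  let J : ModuleCat.{u} Sᵐᵒᵖ := Injective.under (ModuleCat.of Sᵐᵒᵖ A)
  let i : ModuleCat.of Sᵐᵒᵖ A ⟶ J := Injective.ι _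
  have hi : Function.Injective i.hom :=
    (ModuleCat.mono_iff_injective _).1 (inferInstanceAs (Mono (Injective.ι _)))
  have hJ : Module.Injective Sᵐᵒᵖ J :=
    Module.injective_module_of_injective_object Sᵐᵒᵖ J
      (inj := inferInstanceAs (Injective (Injective.under (ModuleCat.of Sᵐᵒᵖ A))))
  exact ⟨↥J, _, inferInstance, inferInstance, inferInstance, inferInstance, i.hom, _, hJ,
    isShortExact_mkQ_range hi⟩

/-- `Tor_{n+1}` with right modules detects flatness; here it appears through its character dual
`Ext^{n+1}(M, A⁺)`. -/
theorem IsFlatMod.subsingleton_ext {M : ModuleCat.{u} S} (hM : IsFlatMod S M) (n : ℕ) (A : Type u)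
    [AddCommGroup A] [Module Sᵐᵒᵖ A] : Subsingleton (Ext M (characterDual S A) (n + 1)) := by
  induction n generalizing A with
  | zero =>
    obtain ⟨N, P, _, _, _, _, ι, π, hι, _, h⟩ := exists_characterDual_presentation (S := S) A
    have := Ext.subsingleton_of_injective M (characterDual S P) 0
    exact h.subsingleton_ext_one_covariant (A := characterDual S A) (B := characterDual S P)
      (C := characterDual S N) M (NTensor.lmap_injective_iff.1 (hM N P ι hι))
  | succ n ih =>
    obtain ⟨N, P, _, _, _, _, ι, π, hι, _, h⟩ := exists_characterDual_presentation (S := S) A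
    have := Ext.subsingleton_of_injective M (characterDual S P) (n + 1)
    have := ih N
    exact h.subsingleton_ext_covariant_left (A := characterDual S A) (B := characterDual S P)
      (C := characterDual S N) M (n + 1)

theorem isFlatMod_of_subsingleton_ext {M : ModuleCat.{u} S}
    (hM : ∀ (A : Type u) [AddCommGroup A] [Module Sᵐᵒᵖ A],
      Subsingleton (Ext M (characterDual S A) 1)) : IsFlatMod S M := by
  intro A B _ _ _ _ f hf
  rw [NTensor.lmap_injective_iff]
  have h : IsShortExact f _ := isShortExact_mkQ_range hf
  have h' : IsShortExact (S := S) (characterMap (LinearMap.range f).mkQ) (characterMap f) :=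
    ⟨characterMap_injective h.surjective, characterMap_surjective h.injective,
      characterMap_exact h.exact⟩
  have := hM (B ⧸ LinearMap.range f)
  exact h'.exists_lift (A := characterDual S (B ⧸ LinearMap.range f)) (B := characterDual S B)
      (C := characterDual S A) M

theorem isFlatMod_of_projective (P : ModuleCat.{u} S) [Projective P] : IsFlatMod S P :=
  isFlatMod_of_subsingleton_ext fun A _ _ =>
    Ext.subsingleton_of_projective P (characterDual S A) 0

theorem isFlatMod_of_subsingleton (M : ModuleCat.{u} S) [Subsingleton M] : IsFlatMod S M :=
  fun A B _ _ _ _ f _ => NTensor.lmap_injective_iff.2 fun φ =>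
    ⟨0, LinearMap.ext fun m => by rw [Subsingleton.elim m 0, map_zero, map_zero]⟩

/-- There is a short exact sequence `0 → A → F → B → 0` with `F` flat. -/
def FlatStep (A B : ModuleCat.{u} S) : Prop :=
  ∃ (F : ModuleCat.{u} S) (f : A →ₗ[S] F) (g : F →ₗ[S] B), IsFlatMod S F ∧ IsShortExact f g

/-- `Tor_i(I, M) = 0` for all `i > n` and all injective right modules `I`, expressed through the
character dual `Ext^i(M, I⁺)`. -/
def TorInjVanishAbove (n : ℕ) (M : ModuleCat.{u} S) : Prop :=
  ∀ (I : Type u) [AddCommGroup I] [Module Sᵐᵒᵖ I], Module.Injective Sᵐᵒᵖ I →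
    ∀ i, n ≤ i → Subsingleton (Ext M (characterDual S I) (i + 1))

theorem IsFlatMod.torInjVanishAbove {M : ModuleCat.{u} S} (hM : IsFlatMod S M) :
    TorInjVanishAbove 0 M :=
  fun I _ _ _ i _ => hM.subsingleton_ext i I

theorem IsShortExact.torInjVanishAbove_left {A B C : ModuleCat.{u} S} {f : A →ₗ[S] B}
    {g : B →ₗ[S] C} (h : IsShortExact f g) (hB : TorInjVanishAbove 0 B)
    (hC : TorInjVanishAbove 0 C) : TorInjVanishAbove 0 A := fun I _ _ hI i _ => by
  have := hB I hI i i.zero_le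
  have := hC I hI (i + 1) (i + 1).zero_le
  exact h.subsingleton_ext_left _ (i + 1)

theorem TorInjVanishAbove.exists_flatStep {M : ModuleCat.{u} S} (hM : TorInjVanishAbove 0 M) :
    ∃ K, FlatStep K M ∧ TorInjVanishAbove 0 K := by
  obtain ⟨K, P, f, g, _, h⟩ := exists_free_presentation M
  have hP := isFlatMod_of_projective P
  exact ⟨K, ⟨P, f, g, hP, h⟩, h.torInjVanishAbove_left hP.torInjVanishAbove hM⟩

/-- Splicing a doubly infinite family of short exact sequences produces a complete flat
resolution. -/
theorem isGorensteinFlat_of_forall_flatStep {Z : ℤ → ModuleCat.{u} S}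
    (hZ : ∀ n, FlatStep (Z n) (Z (n + 1))) (hT : ∀ n, TorInjVanishAbove 0 (Z n)) :
    IsGorensteinFlat S (Z 1) := by
  choose F f g hF h using hZ
  have hdd (n : ℤ) : (f (n + 1 + 1) ∘ₗ g (n + 1)) ∘ₗ (f (n + 1) ∘ₗ g n) = 0 := by
    ext x
    simp [(h (n + 1)).exact.apply_apply_eq_zero]
  refine ⟨F, fun n => f (n + 1) ∘ₗ g n, hF, fun n x => ?_, ⟨?_⟩, fun I _ _ hI n => ?_⟩
  · constructor
    · intro hx
      obtain ⟨z, rfl⟩ := ((h (n + 1)).exact x).1 ((h (n + 1 + 1)).injective (by simpa using hx))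
      obtain ⟨y, rfl⟩ := (h n).surjective z
      exact ⟨y, rfl⟩
    · rintro ⟨y, rfl⟩
      exact LinearMap.congr_fun (hdd n) y
  · refine (LinearEquiv.ofInjective _ (h (0 + 1)).injective).trans (LinearEquiv.ofEq _ _ ?_)
    rw [LinearMap.range_comp, LinearMap.range_eq_top.2 (h 0).surjective, Submodule.map_top]
  · refine (NTensor.rmap_exact_iff (hdd n)).2 fun φ hφ => ?_
    obtain ⟨χ, hχ⟩ := exists_comp_eq_of_surjective (h (n + 1)).surjective φ fun x hx => by
      obtain ⟨z, rfl⟩ := ((h (n + 1)).exact x).1 hx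
      obtain ⟨y, rfl⟩ := (h n).surjective z
      exact LinearMap.congr_fun hφ y
    have := hT (n + 1 + 1 + 1) I hI 0 le_rfl
    obtain ⟨ψ, hψ⟩ := (h (n + 1 + 1)).exists_extension (characterDual S I) χ
    refine ⟨ψ, LinearMap.ext fun x => ?_⟩
    exact (LinearMap.congr_fun hψ _).trans (hχ x)

theorem isGorensteinFlat_of_forall_flatStep' {Z : ℤ → ModuleCat.{u} S}
    (hZ : ∀ n, FlatStep (Z n) (Z (n + 1))) (hT : ∀ n, TorInjVanishAbove 0 (Z n)) (k : ℤ) :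
    IsGorensteinFlat S (Z k) := by
  have := isGorensteinFlat_of_forall_flatStep (Z := fun n => Z (n + (k - 1)))
    (fun n => by
      have := hZ (n + (k - 1))
      rwa [add_right_comm] at this) fun n => hT _
  rwa [add_sub_cancel] at this

/-- Coinduction principle for Gorenstein flat modules. -/
theorem isGorensteinFlat_of_coinduction (Q : ModuleCat.{u} S → Prop)
    (hT : ∀ M, Q M → TorInjVanishAbove 0 M) (hQ : ∀ M, Q M → ∃ M', FlatStep M M' ∧ Q M')
    {M : ModuleCat.{u} S} (hM : Q M) : IsGorensteinFlat S M := by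
  choose r hr hrQ using hQ
  choose l hl hlT using fun (M : ModuleCat.{u} S) (hM : TorInjVanishAbove 0 M) =>
    hM.exists_flatStep
  let right (n : ℕ) : {M : ModuleCat.{u} S // Q M} :=
    Nat.rec ⟨M, hM⟩ (fun _ X => ⟨r X.1 X.2, hrQ X.1 X.2⟩) n
  let left (n : ℕ) : {M : ModuleCat.{u} S // TorInjVanishAbove 0 M} :=
    Nat.rec ⟨M, hT M hM⟩ (fun _ X => ⟨l X.1 X.2, hlT X.1 X.2⟩) n
  let Z : ℤ → ModuleCat.{u} S
    | Int.ofNat n => (right n).1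
    | Int.negSucc n => (left (n + 1)).1
  refine isGorensteinFlat_of_forall_flatStep' (Z := Z) (fun n => ?_) (fun n => ?_) 0
  · rcases n with n | n
    · exact hr (right n).1 (right n).2
    · cases n with
      | zero => exact hl M (hT M hM)
      | succ n => exact hl (left (n + 1)).1 (left (n + 1)).2
  · rcases n with n | n
    · exact hT _ (right n).2
    · exact (left (n + 1)).2

theorem IsFlatMod.isGorensteinFlat {M : ModuleCat.{u} S} (hM : IsFlatMod S M) :
    IsGorensteinFlat S M :=
  isGorensteinFlat_of_coinduction (IsFlatMod S) (fun _ h => h.torInjVanishAbove)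
    (fun M h => ⟨ModuleCat.of S PUnit,
      ⟨M, LinearMap.id, 0, h, Function.injective_id, fun _ => ⟨0, Subsingleton.elim _ _⟩,
        fun x => by simp⟩, isFlatMod_of_subsingleton _⟩) hM

theorem FlatStep.subsingleton_ext_succ {A B : ModuleCat.{u} S} (h : FlatStep A B) (I : Type u)
    [AddCommGroup I] [Module Sᵐᵒᵖ I] (n : ℕ) [Subsingleton (Ext A (characterDual S I) n)] :
    Subsingleton (Ext B (characterDual S I) (n + 1)) := by
  obtain ⟨F, f, g, hF, h⟩ := h
  have := hF.subsingleton_ext n I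
  exact h.subsingleton_ext_right _ n

theorem IsGorensteinFlat.torInjVanishAbove_and_exists_flatStep {M : ModuleCat.{u} S}
    (hM : IsGorensteinFlat S M) :
    TorInjVanishAbove 0 M ∧ ∃ M', FlatStep M M' ∧ IsGorensteinFlat S M' := by
  obtain ⟨F, d, hF, hd, ⟨e⟩, hI⟩ := hM
  have hdd (n : ℤ) (x : F n) : d (n + 1) (d n x) = 0 := (hd n).apply_apply_eq_zero x
  let Z (n : ℤ) : ModuleCat.{u} S := ModuleCat.of S (LinearMap.ker (d n))
  let p (n : ℤ) : F n →ₗ[S] Z (n + 1) := (d n).codRestrict _ (hdd n)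
  have hp (n : ℤ) : IsShortExact (LinearMap.ker (d n)).subtype (p n) := by
    refine ⟨Subtype.val_injective, fun z => ?_, fun x => ?_⟩
    · obtain ⟨y, hy⟩ := (hd n z.1).1 z.2
      exact ⟨y, Subtype.ext hy⟩
    · rw [← LinearMap.exact_subtype_ker_map (d n) x]
      exact Subtype.ext_iff
  have hZ (n : ℤ) : FlatStep (Z n) (Z (n + 1)) := ⟨F n, _, p n, hF n, hp n⟩
  have hext (n : ℤ) (I : Type u) [AddCommGroup I] [Module Sᵐᵒᵖ I] (hI' : Module.Injective Sᵐᵒᵖ I) :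
      Subsingleton (Ext (Z (n + 1 + 1 + 1)) (characterDual S I) 1) := by
    have := (hF (n + 1 + 1)).subsingleton_ext 0 I
    refine (hp (n + 1 + 1)).subsingleton_ext_one_right (A := Z (n + 1 + 1)) _ fun φ => ?_
    have h0 : d (n + 1) ∘ₗ d n = 0 := LinearMap.ext (hdd n)
    obtain ⟨ψ, hψ⟩ := (NTensor.rmap_exact_iff h0).1 (hI I hI' n) (φ ∘ₗ p (n + 1)) (by
      ext x : 1
      have : p (n + 1) (d n x) = 0 := Subtype.ext (hdd n x)
      simp [this])
    refine ⟨ψ, LinearMap.ext fun z => ?_⟩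
    obtain ⟨y, rfl⟩ := (hp (n + 1)).surjective z
    exact LinearMap.congr_fun hψ y
  have hT (n : ℤ) : TorInjVanishAbove 0 (Z n) := by
    intro I _ _ hI' i _
    induction i generalizing n with
    | zero =>
      have := hext (n - 3) I hI'
      rwa [show n - 3 + 1 + 1 + 1 = n by ring] at this
    | succ i ih =>
      have := ih (n - 1) (Nat.zero_le _)
      have := (hZ (n - 1)).subsingleton_ext_succ I (i + 1)
      rwa [sub_add_cancel] at this
  let e' : M ≃ₗ[S] Z (0 + 1) := e.trans (LinearEquiv.ofEq _ _ (hd 0).linearMap_ker_eq.symm)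
  have hM : FlatStep M (Z (0 + 1 + 1)) := by
    obtain ⟨F', f, g, hF', h⟩ := hZ (0 + 1)
    exact ⟨F', _, g, hF', h.congr_left e'⟩
  refine ⟨?_, _, hM, isGorensteinFlat_of_forall_flatStep' hZ hT _⟩
  obtain ⟨F', f, g, hF', h⟩ := hM
  exact h.torInjVanishAbove_left hF'.torInjVanishAbove (hT _)

theorem FlatStep.isGorensteinFlat {M M' : ModuleCat.{u} S} (h : FlatStep M M')
    (hM' : IsGorensteinFlat S M') : IsGorensteinFlat S M := by
  refine isGorensteinFlat_of_coinduction
    (fun M => TorInjVanishAbove 0 M ∧ ∃ M', FlatStep M M' ∧ IsGorensteinFlat S M')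
    (fun _ h => h.1)
    (fun N ⟨_, N', hN, hN'⟩ => ⟨N', hN, hN'.torInjVanishAbove_and_exists_flatStep⟩)
    ⟨?_, M', h, hM'⟩
  obtain ⟨F, f, g, hF, h⟩ := h
  exact h.torInjVanishAbove_left hF.torInjVanishAbove hM'.torInjVanishAbove_and_exists_flatStep.1

end GorensteinFlat

section Dimension

open CategoryTheory CategoryTheory.Abelian

variable {S : Type u} [Ring S]

theorem flatDimLE.to_gflatDimLE {n : ℕ} {M : ModuleCat.{u} S} (h : flatDimLE S n M) :
    gflatDimLE S n M := by
  induction n generalizing M with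
  | zero => exact IsFlatMod.isGorensteinFlat h
  | succ n ih =>
    obtain ⟨K, F, ι, π, hι, hπ, hex, hF, hK⟩ := h
    exact ⟨K, F, ι, π, hι, hπ, hex, hF.isGorensteinFlat, ih hK⟩

theorem flatDimLE.subsingleton_ext {n : ℕ} {M : ModuleCat.{u} S} (h : flatDimLE S n M) (i : ℕ)
    (hi : n ≤ i) (A : Type u) [AddCommGroup A] [Module Sᵐᵒᵖ A] :
    Subsingleton (Ext M (characterDual S A) (i + 1)) := by
  induction n generalizing M i with
  | zero => exact IsFlatMod.subsingleton_ext h i A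
  | succ n ih =>
    obtain ⟨K, F, ι, π, hι, hπ, hex, hF, hK⟩ := h
    obtain ⟨i, rfl⟩ : ∃ j, i = j + 1 := ⟨i - 1, by lia⟩
    have := ih hK i (by lia)
    exact FlatStep.subsingleton_ext_succ ⟨F, ι, π, hF, hι, hπ, hex⟩ A (i + 1)

theorem flatDimLE_of_subsingleton_ext {n : ℕ} {M : ModuleCat.{u} S}
    (h : ∀ (A : Type u) [AddCommGroup A] [Module Sᵐᵒᵖ A],
      Subsingleton (Ext M (characterDual S A) (n + 1))) : flatDimLE S n M := by
  induction n generalizing M with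
  | zero => exact isFlatMod_of_subsingleton_ext h
  | succ n ih =>
    obtain ⟨K, P, f, g, _, hfg⟩ := exists_free_presentation M
    refine ⟨K, P, f, g, hfg.injective, hfg.surjective, hfg.exact, isFlatMod_of_projective P,
      ih fun A _ _ => ?_⟩
    have := h A
    have := Ext.subsingleton_of_projective P (characterDual S A) n
    exact hfg.subsingleton_ext_left _ (n + 1)

theorem gflatDimLE.torInjVanishAbove {n : ℕ} {M : ModuleCat.{u} S} (h : gflatDimLE S n M) :
    TorInjVanishAbove n M := by
  induction n generalizing M with
  | zero => exact (IsGorensteinFlat.torInjVanishAbove_and_exists_flatStep h).1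
  | succ n ih =>
    obtain ⟨K, G, ι, π, hι, hπ, hex, hG, hK⟩ := h
    intro I _ _ hI i hi
    obtain ⟨i, rfl⟩ : ∃ j, i = j + 1 := ⟨i - 1, by lia⟩
    have := ih hK I hI i (by lia)
    have := hG.torInjVanishAbove_and_exists_flatStep.1 I hI (i + 1) (Nat.zero_le _)
    exact (IsShortExact.mk hι hπ hex).subsingleton_ext_right _ (i + 1)

/-- A module of finite flat dimension has flat dimension at most its Gorenstein flat dimension. -/
theorem flatDimLE.of_gflatDimLE {n m : ℕ} {M : ModuleCat.{u} S} (h : flatDimLE S n M)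
    (hG : gflatDimLE S m M) : flatDimLE S m M := by
  refine flatDimLE_of_subsingleton_ext ?_
  have key (k : ℕ) : ∀ i, m ≤ i → n ≤ i + k → ∀ (A : Type u) [AddCommGroup A] [Module Sᵐᵒᵖ A],
      Subsingleton (Ext M (characterDual S A) (i + 1)) := by
    induction k with
    | zero => exact fun i _ hn A _ _ => h.subsingleton_ext i hn A
    | succ k ih =>
      intro i hm hn A _ _
      obtain ⟨I, D, _, _, _, _, ι, π, hI, hex⟩ := exists_injective_copresentation (S := S) A
      have h' : IsShortExact (S := S) (characterMap π) (characterMap ι) :=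
        ⟨characterMap_injective hex.surjective, characterMap_surjective hex.injective,
          characterMap_exact hex.exact⟩
      have := hG.torInjVanishAbove I hI i hm
      have := ih (i + 1) (by lia) (by lia) D
      exact h'.subsingleton_ext_covariant_right (A := characterDual S D)
        (B := characterDual S I) (C := characterDual S A) M (i + 1)
  exact fun A _ _ => key n m le_rfl (by lia) A

/-- A kernel of an epimorphism from a module of flat dimension at most `n` onto a Gorenstein flat
module has Gorenstein flat dimension at most `n`. -/
theorem IsShortExact.gflatDimLE_left {n : ℕ} {M L G : ModuleCat.{u} S} {f : M →ₗ[S] L} {g : L →ₗ[S] G}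
    (h : IsShortExact f g) (hL : flatDimLE S n L) (hG : IsGorensteinFlat S G) :
    gflatDimLE S n M := by
  cases n with
  | zero => exact FlatStep.isGorensteinFlat ⟨L, f, g, hL, h⟩ hG
  | succ n =>
    obtain ⟨K, F, ι, π, hι, hπ, hex, hF, hK⟩ := hL
    obtain ⟨N, j, i, p, hj, hi⟩ := (IsShortExact.mk hι hπ hex).exists_ker_comp h
    exact ⟨K, N, i, p, hi.injective, hi.surjective, hi.exact,
      FlatStep.isGorensteinFlat ⟨F, j, _, hF, hj⟩ hG, hK.to_gflatDimLE⟩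

/-- Over a GF-closed ring, a module of Gorenstein flat dimension at most `n` embeds into a module
of flat dimension at most `n` with Gorenstein flat cokernel. -/
theorem IsGFClosed.exists_isShortExact (hS : IsGFClosed S) {n : ℕ} {M : ModuleCat.{u} S}
    (hM : gflatDimLE S n M) : ∃ (L G : ModuleCat.{u} S) (f : M →ₗ[S] L) (g : L →ₗ[S] G),
      IsShortExact f g ∧ flatDimLE S n L ∧ IsGorensteinFlat S G := by
  induction n generalizing M with
  | zero =>
    obtain ⟨-, G, ⟨F, f, g, hF, h⟩, hG⟩ :=
      IsGorensteinFlat.torInjVanishAbove_and_exists_flatStep hM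
    exact ⟨F, G, f, g, h, hF, hG⟩
  | succ n ih =>
    obtain ⟨N, G, ι, π, hι, hπ, hex, hG, hN⟩ := hM
    obtain ⟨L, G', f, g, h, hL, hG'⟩ := ih hN
    obtain ⟨X, i, p, i', p', hip, hip'⟩ := (IsShortExact.mk hι hπ hex).exists_pushout h
    have hX := hS _ _ _ i' p' hip'.injective hip'.surjective hip'.exact hG hG'
    obtain ⟨-, X', ⟨H, a, b, hH, hab⟩, hX'⟩ := hX.torInjVanishAbove_and_exists_flatStep
    obtain ⟨Q, q, j, r, hq, hjr⟩ := hip.exists_coker_comp hab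
    exact ⟨Q, X', j, r, hjr, ⟨L, H, _, q, hq.injective, hq.surjective, hq.exact, hH, hL⟩, hX'⟩

theorem gflatDim_le_of_gflatDimLE {n : ℕ} {M : ModuleCat.{u} S} (h : gflatDimLE S n M) :
    gflatDim S M ≤ n :=
  sInf_le ⟨n, rfl, h⟩

theorem flatDim_le_of_flatDimLE {n : ℕ} {M : ModuleCat.{u} S} (h : flatDimLE S n M) :
    flatDim S M ≤ n :=
  sInf_le ⟨n, rfl, h⟩

theorem exists_flatDimLE_of_ne_top {M : ModuleCat.{u} S} (h : flatDim S M ≠ ⊤) :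
    ∃ n : ℕ, flatDim S M = n ∧ flatDimLE S n M := by
  have hne : {d : ℕ∞ | ∃ n : ℕ, d = n ∧ flatDimLE S n M}.Nonempty :=
    Set.nonempty_iff_ne_empty.2 fun he => h (by rw [flatDim, he, sInf_empty])
  exact csInf_mem hne

theorem exists_gflatDimLE_of_ne_top {M : ModuleCat.{u} S} (h : gflatDim S M ≠ ⊤) :
    ∃ n : ℕ, gflatDim S M = n ∧ gflatDimLE S n M := by
  have hne : {d : ℕ∞ | ∃ n : ℕ, d = n ∧ gflatDimLE S n M}.Nonempty :=
    Set.nonempty_iff_ne_empty.2 fun he => h (by rw [gflatDim, he, sInf_empty])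
  exact csInf_mem hne

theorem gflatDim_eq_flatDim_of_ne_top {M : ModuleCat.{u} S} (h : flatDim S M ≠ ⊤) :
    gflatDim S M = flatDim S M := by
  obtain ⟨n, hn, hM⟩ := exists_flatDimLE_of_ne_top h
  have hle := gflatDim_le_of_gflatDimLE hM.to_gflatDimLE
  obtain ⟨m, hm, hM'⟩ := exists_gflatDimLE_of_ne_top (ne_top_of_le_ne_top (ENat.natCast_ne_top n) hle)
  refine le_antisymm (hle.trans_eq hn.symm) ?_
  rw [hm]
  exact flatDim_le_of_flatDimLE (hM.of_gflatDimLE hM')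

theorem finitisticFlatDim_le_finitisticGFlatDim :
    finitisticFlatDim S ≤ finitisticGFlatDim S := by
  refine sSup_le_sSup ?_
  rintro _ ⟨hd, M, rfl⟩
  exact ⟨hd, M, gflatDim_eq_flatDim_of_ne_top hd⟩

theorem IsGFClosed.finitisticFlatDim_eq (hS : IsGFClosed S) :
    finitisticFlatDim S = finitisticGFlatDim S := by
  refine le_antisymm finitisticFlatDim_le_finitisticGFlatDim (sSup_le ?_)
  rintro _ ⟨hd, M, rfl⟩
  obtain ⟨n, -, hM⟩ := exists_gflatDimLE_of_ne_top hd
  obtain ⟨L, G, f, g, h, hL, hG⟩ := hS.exists_isShortExact hM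
  have hL' : flatDim S L ≠ ⊤ :=
    ne_top_of_le_ne_top (ENat.natCast_ne_top n) (flatDim_le_of_flatDimLE hL)
  obtain ⟨k, hk, hLk⟩ := exists_flatDimLE_of_ne_top hL'
  calc gflatDim S M ≤ k := gflatDim_le_of_gflatDimLE (h.gflatDimLE_left hLk hG)
    _ = flatDim S L := hk.symm
    _ ≤ finitisticFlatDim S := le_sSup ⟨hL', L, rfl⟩

end Dimension

/-- **Proposition 2.7 (second part).**  If `R` is left GF-closed then `l.FFD(R) = l.FGFD(R)`,
and if `R` is right GF-closed then `r.FFD(R) = r.FGFD(R)`. -/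
theorem finitisticFlatDim_eq_finitisticGFlatDim_of_isGFClosed (R : Type u) [Ring R] :
    (IsGFClosed R → finitisticFlatDim R = finitisticGFlatDim R) ∧
    (IsGFClosed Rᵐᵒᵖ → finitisticFlatDim Rᵐᵒᵖ = finitisticGFlatDim Rᵐᵒᵖ) := by
  exact ⟨fun h => h.finitisticFlatDim_eq, fun h => h.finitisticFlatDim_eq⟩
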